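/- For natural numbers n, m, s with 1 ≤ m ≤ n and s ≥ 2, the Krawtchouk polynomial K_{m,n,s} has exactly m distinct real roots, all lying in the open interval (0, n). -/

import Mathlib

open Polynomial Finset

/-- `P j` is the polynomial `X(X-1)⋯(X-j+1)/j!` (with `P 0 = 1`). -/
noncomputable def P (j : ℕ) : Polynomial ℝ :=
  Polynomial.C (1 / (j.factorial : ℝ)) *
    ∏ i ∈ Finset.range j, (Polynomial.X - Polynomial.C (i : ℝ))

/-- The Krawtchouk polynomial `K_{m,n,s}(X) = Σ_{j=0}^m (-1)^j P_j(X) P_{m-j}(n-X) (s-1)^{m-j}`. -/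
noncomputable def K (m n s : ℕ) : Polynomial ℝ :=
  ∑ j ∈ Finset.range (m + 1),
    Polynomial.C ((-1 : ℝ) ^ j * ((s : ℝ) - 1) ^ (m - j)) *
      (P j * (P (m - j)).comp (Polynomial.C (n : ℝ) - Polynomial.X))

lemma P_eval_natCast (j k : ℕ) : (P j).eval (k : ℝ) = (k.choose j : ℝ) := by
  rw [Nat.cast_choose_eq_descPochhammer_div, P, eval_mul, eval_C, eval_prod,
    descPochhammer_eval_eq_prod_range]
  simp only [eval_sub, eval_X, eval_C]
  ring

lemma coeff_one_add_C_mul_X_pow (a : ℝ) (k j : ℕ) :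
    ((1 + C a * X : ℝ[X]) ^ k).coeff j = a ^ j * (k.choose j : ℝ) := by
  have h : (1 + C a * X : ℝ[X]) ^ k = ((1 + X) ^ k : ℝ[X]).comp (C a * X) := by simp
  rw [h, comp_C_mul_X_coeff, coeff_one_add_X_pow, mul_comm]

/-- Generating function of the values of the Krawtchouk polynomials at an integer point. -/
lemma K_eval_natCast (m n s x : ℕ) (hx : x ≤ n) :
    (K m n s).eval (x : ℝ) =
      ((1 + C (-1) * X : ℝ[X]) ^ x * (1 + C ((s : ℝ) - 1) * X) ^ (n - x)).coeff m := by
  rw [coeff_mul, Finset.Nat.sum_antidiagonal_eq_sum_range_succ_mk, K, eval_finsetSum]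
  refine Finset.sum_congr rfl fun j _ => ?_
  have h : (n : ℝ) - x = ((n - x : ℕ) : ℝ) := by rw [Nat.cast_sub hx]
  simp only [coeff_one_add_C_mul_X_pow, eval_mul, eval_C, eval_comp, eval_sub, eval_X, h,
    P_eval_natCast]
  ring

lemma natDegree_P_le (j : ℕ) : (P j).natDegree ≤ j := by
  refine (natDegree_C_mul_le _ _).trans ?_
  rw [natDegree_finsetProd_X_sub_C_eq_card, Finset.card_range]

lemma natDegree_K_le (m n s : ℕ) : (K m n s).natDegree ≤ m := by
  refine natDegree_sum_le_of_forall_le _ _ fun j hj => ?_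
  have hj : j ≤ m := Nat.lt_succ_iff.mp (Finset.mem_range.mp hj)
  refine (natDegree_C_mul_le _ _).trans (natDegree_mul_le.trans ?_)
  have h₁ : ((P (m - j)).comp (C (n : ℝ) - X)).natDegree ≤ m - j := by
    refine natDegree_comp_le.trans ?_
    have h₂ : (C (n : ℝ) - X).natDegree ≤ 1 := by compute_degree
    exact (Nat.mul_le_mul (natDegree_P_le _) h₂).trans (by simp)
  have := natDegree_P_le j
  omega

lemma K_eval_zero_ne_zero (m n s : ℕ) (hmn : m ≤ n) (hs : 2 ≤ s) : (K m n s).eval 0 ≠ 0 := by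
  have h := K_eval_natCast m n s 0 n.zero_le
  rw [Nat.cast_zero, pow_zero, one_mul, Nat.sub_zero, coeff_one_add_C_mul_X_pow] at h
  rw [h]
  have hs' : (2 : ℝ) ≤ s := by exact_mod_cast hs
  have := Nat.choose_pos hmn
  have hq : 0 < (s : ℝ) - 1 := by linarith
  positivity

/-- If `a + b` is constant and `a` is linear, a polynomial weight of degree at most `d` in the
binomial expansion of `(a + b) ^ n` yields a polynomial of degree at most `d`. -/
lemma natDegree_sum_choose_mul_le {a b : ℝ[X]} (ha : a.natDegree ≤ 1)
    (hab : (a + b).natDegree = 0) (d n : ℕ) (g : ℝ[X]) (hg : g.natDegree ≤ d) :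
    (∑ x ∈ range (n + 1),
      C ((n.choose x : ℝ) * g.eval (x : ℝ)) * (a ^ x * b ^ (n - x))).natDegree ≤ d := by
  have hconst : ∀ (n : ℕ) (c : ℝ), (∑ x ∈ range (n + 1),
      C ((n.choose x : ℝ) * c) * (a ^ x * b ^ (n - x))).natDegree = 0 := by
    intro n c
    have h : ∑ x ∈ range (n + 1), C ((n.choose x : ℝ) * c) * (a ^ x * b ^ (n - x)) =
        C c * (a + b) ^ n := by
      rw [add_pow, mul_sum]
      refine sum_congr rfl fun x _ => ?_
      rw [C_mul, map_natCast]
      ring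
    rw [h]
    refine Nat.le_zero.mp ((natDegree_C_mul_le _ _).trans (natDegree_pow_le.trans ?_))
    rw [hab, mul_zero]
  induction d generalizing n g with
  | zero =>
    rw [eq_C_of_natDegree_le_zero hg]
    simp only [eval_C]
    exact (hconst n _).le
  | succ d ih =>
    cases n with
    | zero => simp
    | succ n =>
      have hh : (g.divX.comp (X + 1)).natDegree ≤ d := by
        refine natDegree_comp_le.trans ?_
        have h₁ : (X + 1 : ℝ[X]).natDegree ≤ 1 := by compute_degree
        have h₂ : g.divX.natDegree ≤ d := by rw [natDegree_divX_eq_natDegree_tsub_one]; omega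
        exact (Nat.mul_le_mul h₂ h₁).trans (by simp)
      have key : ∑ x ∈ range (n + 1 + 1),
          C (((n + 1).choose x : ℝ) * g.eval (x : ℝ)) * (a ^ x * b ^ (n + 1 - x)) =
          ∑ x ∈ range (n + 1 + 1),
            C (((n + 1).choose x : ℝ) * g.coeff 0) * (a ^ x * b ^ (n + 1 - x)) +
          C ((n : ℝ) + 1) * (a * ∑ x ∈ range (n + 1),
            C ((n.choose x : ℝ) * (g.divX.comp (X + 1)).eval (x : ℝ)) *
              (a ^ x * b ^ (n - x))) := by
        have hg' : ∀ t : ℝ, g.eval t = g.coeff 0 + t * g.divX.eval t := by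
          intro t
          have h := congrArg (eval t) (X_mul_divX_add g)
          rw [eval_add, eval_mul, eval_X, eval_C] at h
          rw [← h, add_comm]
        have hsplit : ∀ x ∈ range (n + 1 + 1),
            C (((n + 1).choose x : ℝ) * g.eval (x : ℝ)) * (a ^ x * b ^ (n + 1 - x)) =
            C (((n + 1).choose x : ℝ) * g.coeff 0) * (a ^ x * b ^ (n + 1 - x)) +
            C (((n + 1).choose x : ℝ) * (x * g.divX.eval (x : ℝ))) *
              (a ^ x * b ^ (n + 1 - x)) := by
          intro x _
          rw [hg', mul_add, C_add, add_mul]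
        rw [sum_congr rfl hsplit, sum_add_distrib]
        congr 1
        rw [sum_range_succ', mul_sum, mul_sum]
        simp only [Nat.cast_zero, zero_mul, mul_zero, C_0, add_zero]
        refine sum_congr rfl fun x _ => ?_
        have hc : ((n : ℝ) + 1) * n.choose x = (n + 1).choose (x + 1) * ((x : ℝ) + 1) := by
          exact_mod_cast Nat.add_one_mul_choose_eq n x
        have hC : C (((n + 1).choose (x + 1) : ℝ) *
            (((x + 1 : ℕ) : ℝ) * g.divX.eval ((x + 1 : ℕ) : ℝ))) =
            C ((n : ℝ) + 1) * C ((n.choose x : ℝ) * (g.divX.comp (X + 1)).eval (x : ℝ)) := by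
          rw [← C_mul, ← mul_assoc, ← mul_assoc, hc]
          simp
        rw [hC, Nat.add_sub_add_right]
        ring
      rw [key]
      refine natDegree_add_le_of_degree_le ((hconst _ _).le.trans (Nat.zero_le _)) ?_
      refine (natDegree_C_mul_le _ _).trans (natDegree_mul_le.trans ?_)
      have := ih n _ hh
      omega

/-- `K m n s` is orthogonal to all polynomials of degree less than `m`, for the weight
`x ↦ n.choose x * (s - 1) ^ x` on `{0, …, n}`. -/
lemma K_orthogonal (m n s : ℕ) (g : ℝ[X]) (hg : g.natDegree < m) :
    ∑ x ∈ range (n + 1), (n.choose x : ℝ) * ((s : ℝ) - 1) ^ x *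
      ((K m n s).eval (x : ℝ) * g.eval (x : ℝ)) = 0 := by
  set q : ℝ := (s : ℝ) - 1 with hq
  have ha : (C q * (1 + C (-1) * X) : ℝ[X]).natDegree ≤ 1 := by compute_degree
  have hab : (C q * (1 + C (-1) * X) + (1 + C q * X) : ℝ[X]).natDegree = 0 := by
    have : (C q * (1 + C (-1) * X) + (1 + C q * X) : ℝ[X]) = C (q + 1) := by
      simp only [C_add, C_neg, C_1]
      ring
    rw [this, natDegree_C]
  have h := coeff_eq_zero_of_natDegree_lt
    ((natDegree_sum_choose_mul_le ha hab _ n g le_rfl).trans_lt hg)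
  rw [finsetSum_coeff] at h
  rw [← h]
  refine sum_congr rfl fun x hx => ?_
  rw [K_eval_natCast m n s x (Nat.lt_succ_iff.mp (mem_range.mp hx)), coeff_C_mul, mul_pow,
    ← C_pow, mul_assoc (C (q ^ x)), coeff_C_mul]
  ring

/-- Multiplying by suitable distinct linear factors at roots in an open interval makes a real
polynomial of constant sign on the closed interval. -/
lemma exists_roots_mul_prod_constant_sign {a b : ℝ} (hab : a < b) (p : ℝ[X]) (hp : p ≠ 0) :
    ∃ S : Finset ℝ, (∀ c ∈ S, c ∈ Set.Ioo a b ∧ p.eval c = 0) ∧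
      ((∀ x ∈ Set.Icc a b, 0 ≤ (p * ∏ c ∈ S, (X - C c)).eval x) ∨
        (∀ x ∈ Set.Icc a b, (p * ∏ c ∈ S, (X - C c)).eval x ≤ 0)) := by
  induction hd : p.natDegree generalizing p with
  | zero =>
    refine ⟨∅, by simp, ?_⟩
    rw [eq_C_of_natDegree_eq_zero hd]
    simp only [prod_empty, mul_one, eval_C]
    exact (le_total 0 (p.coeff 0)).imp (fun h _ _ => h) (fun h _ _ => h)
  | succ d ih =>
    by_cases hroot : ∃ c ∈ Set.Ioo a b, p.eval c = 0
    · obtain ⟨c, hc, hpc⟩ := hroot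
      obtain ⟨p', rfl⟩ := dvd_iff_isRoot.mpr hpc
      have hp' : p' ≠ 0 := right_ne_zero_of_mul hp
      rw [natDegree_mul (X_sub_C_ne_zero c) hp', natDegree_X_sub_C] at hd
      obtain ⟨S, hS, hsign⟩ := ih p' hp' (by omega)
      by_cases hcS : c ∈ S
      · refine ⟨S.erase c, fun e he => ⟨(hS e (mem_of_mem_erase he)).1, ?_⟩, ?_⟩
        · rw [eval_mul, (hS e (mem_of_mem_erase he)).2, mul_zero]
        · have h : (X - C c) * p' * ∏ e ∈ S.erase c, (X - C e) = p' * ∏ e ∈ S, (X - C e) := by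
            rw [← mul_prod_erase S _ hcS]
            ring
          rwa [h]
      · refine ⟨insert c S, fun e he => ?_, ?_⟩
        · rcases mem_insert.mp he with rfl | he
          · exact ⟨hc, hpc⟩
          · exact ⟨(hS e he).1, by rw [eval_mul, (hS e he).2, mul_zero]⟩
        · have h : ∀ x, ((X - C c) * p' * ∏ e ∈ insert c S, (X - C e)).eval x =
              (x - c) ^ 2 * (p' * ∏ e ∈ S, (X - C e)).eval x := by
            intro x
            rw [prod_insert hcS]
            simp only [eval_mul, eval_sub, eval_X, eval_C]
            ring
          simp only [h]
          exact hsign.imp (fun h x hx => mul_nonneg (sq_nonneg _) (h x hx))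
            (fun h x hx => mul_nonpos_of_nonneg_of_nonpos (sq_nonneg _) (h x hx))
    · push Not at hroot
      refine ⟨∅, by simp, ?_⟩
      simp only [prod_empty, mul_one]
      by_contra! hcon
      obtain ⟨⟨x, hx, hxneg⟩, y, hy, hypos⟩ := hcon
      have hcl : closure (Set.Ioo a b) = Set.Icc a b := closure_Ioo hab.ne
      rw [← hcl, mem_closure_iff] at hx hy
      obtain ⟨x', hx'neg, hx'⟩ := hx {t | p.eval t < 0}
        (isOpen_lt p.continuous continuous_const) hxneg
      obtain ⟨y', hy'pos, hy'⟩ := hy {t | 0 < p.eval t}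
        (isOpen_lt continuous_const p.continuous) hypos
      obtain ⟨c, hc, hpc⟩ := isPreconnected_Ioo.intermediate_value hx' hy'
        p.continuous.continuousOn ⟨le_of_lt hx'neg, le_of_lt hy'pos⟩
      exact hroot c hc hpc

theorem krawtchouk_roots (n m s : ℕ) (hm1 : 1 ≤ m) (hmn : m ≤ n) (hs : 2 ≤ s) :
    ∃ r : Finset ℝ, r.card = m ∧ (↑r : Set ℝ) ⊆ Set.Ioo (0 : ℝ) (n : ℝ) ∧
      ∀ x : ℝ, (K m n s).eval x = 0 ↔ x ∈ r := by
  have hK0 : K m n s ≠ 0 := fun h => K_eval_zero_ne_zero m n s hmn hs (by simp [h])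
  have hn : (0 : ℝ) < n := by exact_mod_cast hm1.trans hmn
  have hs' : (2 : ℝ) ≤ s := by exact_mod_cast hs
  obtain ⟨S, hS, hsign⟩ := exists_roots_mul_prod_constant_sign hn (K m n s) hK0
  have hsub : S ⊆ (K m n s).roots.toFinset := fun c hc => by
    simpa [hK0] using (hS c hc).2
  have hroots : (K m n s).roots.toFinset.card ≤ m :=
    (Multiset.toFinset_card_le _).trans ((card_roots' _).trans (natDegree_K_le m n s))
  have hcard : m ≤ S.card := by
    by_contra! hlt
    set g : ℝ[X] := ∏ c ∈ S, (X - C c) with hg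
    have horth := K_orthogonal m n s g
      (by rwa [hg, natDegree_finsetProd_X_sub_C_eq_card])
    have hw : ∀ x ∈ range (n + 1), 0 < (n.choose x : ℝ) * ((s : ℝ) - 1) ^ x := fun x hx => by
      have := Nat.choose_pos (Nat.lt_succ_iff.mp (mem_range.mp hx))
      have hq : 0 < (s : ℝ) - 1 := by linarith
      positivity
    have hmem : ∀ x ∈ range (n + 1), (x : ℝ) ∈ Set.Icc (0 : ℝ) n := fun x hx =>
      ⟨x.cast_nonneg, by exact_mod_cast Nat.lt_succ_iff.mp (mem_range.mp hx)⟩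
    simp only [eval_mul] at hsign
    have hzero : ∀ x ∈ range (n + 1), (n.choose x : ℝ) * ((s : ℝ) - 1) ^ x *
        ((K m n s).eval (x : ℝ) * g.eval (x : ℝ)) = 0 := by
      rcases hsign with h | h
      · exact (sum_eq_zero_iff_of_nonneg fun x hx =>
          mul_nonneg (hw x hx).le (h x (hmem x hx))).mp horth
      · exact (sum_eq_zero_iff_of_nonpos fun x hx =>
          mul_nonpos_of_nonneg_of_nonpos (hw x hx).le (h x (hmem x hx))).mp horth
    have hKzero : ∀ x ∈ range (n + 1), (K m n s).eval (x : ℝ) = 0 := fun x hx => by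
      rcases mul_eq_zero.mp ((mul_eq_zero.mp (hzero x hx)).resolve_left (hw x hx).ne') with h | h
      · exact h
      · rw [hg, eval_prod, prod_eq_zero_iff] at h
        obtain ⟨c, hc, hxc⟩ := h
        rw [eval_sub, eval_X, eval_C, sub_eq_zero] at hxc
        rw [hxc]
        exact (hS c hc).2
    exact K_eval_zero_ne_zero m n s hmn hs (by simpa using hKzero 0 (by simp))
  have hSeq : S = (K m n s).roots.toFinset := eq_of_subset_of_card_le hsub (hroots.trans hcard)
  refine ⟨S, le_antisymm ((card_le_card hsub).trans hroots) hcard, fun c hc => (hS c hc).1,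
    fun x => ?_⟩
  rw [hSeq]
  simp [hK0]
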